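/- Let e_1, …, e_m be an edge sequence with node locality k, and fix an index i with k + 2 ≤ i ≤ m. Let C be the set of vertices connected to an endpoint of e_{i−k−1} in the graph whose edges are e_1, …, e_{i−1}. If C contains no endpoint of any of the window edges e_{i−k}, …, e_{i−1}, then no edge e_j with j ≥ i has an endpoint in C; consequently, C is the vertex set of a connected component of the full graph formed by all edges e_1, …, e_m, and in particular if some edge has no endpoint in C then the full graph is disconnected. (This invariant is the key step showing that a single-pass recurrent model with hidden state of size O(k) decides connectivity of graphs presented with node locality k.) -/

import Mathlib

/-- A vertex set closed under adjacency is closed under reachability. -/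
theorem SimpleGraph.Reachable.mem_of_adj_closed {V : Type*} {G : SimpleGraph V} {C : Set V}
    (hC : ∀ x y, G.Adj x y → x ∈ C → y ∈ C) {x y : V} (h : G.Reachable x y) (hx : x ∈ C) :
    y ∈ C := by
  obtain ⟨w⟩ := h
  induction w with
  | nil => exact hx
  | cons hadj _ ih => exact ih (hC _ _ hadj hx)

/-- A vertex that reaches an endpoint of an edge of `S` in the graph formed by `S` is itself an
endpoint of an edge of `S`. -/
theorem SimpleGraph.Reachable.exists_mem_of_fromEdgeSet {V : Type*} {S : Set (Sym2 V)} {u v : V}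
    (h : (SimpleGraph.fromEdgeSet S).Reachable v u) {x : Sym2 V} (hx : x ∈ S) (hu : u ∈ x) :
    ∃ y ∈ S, v ∈ y :=
  h.symm.mem_of_adj_closed (C := {v | ∃ y ∈ S, v ∈ y})
    (fun a b hab _ => ⟨s(a, b), ((SimpleGraph.fromEdgeSet_adj S).1 hab).1, Sym2.mem_mk_right a b⟩)
    ⟨x, hx, hu⟩


/-- let `e 1, …, e m` be an edge sequence with node locality `k`, fix an
index `i` with `k + 2 ≤ i ≤ m`, and let `C` be the set of vertices connected to an
endpoint of `e (i−k−1)` in the graph formed by the edges `e 1, …, e (i−1)`. If `C`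
contains no endpoint of any of the window edges `e (i−k), …, e (i−1)`, then no edge
`e j` with `j ≥ i` has an endpoint in `C`; consequently `C` is the vertex set of a
connected component of the graph formed by all edges `e 1, …, e m`, and in particular
if some edge has no endpoint in `C` then that full graph is disconnected. -/
theorem stmt14 {V : Type*} (m k : ℕ) (e : ℕ → Sym2 V)
    (hloc : ∀ (v : V) (a b : ℕ), 1 ≤ a → a ≤ m → 1 ≤ b → b ≤ m →
      v ∈ e a → v ∈ e b → |(a : ℤ) - (b : ℤ)| ≤ k)
    (i : ℕ) (hik : k + 2 ≤ i) (him : i ≤ m)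
    (C : Set V)
    (hC : C = {v : V | ∃ u, u ∈ e (i - k - 1) ∧
      (SimpleGraph.fromEdgeSet {x | ∃ j, 1 ≤ j ∧ j ≤ i - 1 ∧ x = e j}).Reachable v u})
    (hwin : ∀ j, i - k ≤ j → j ≤ i - 1 → ∀ v ∈ e j, v ∉ C) :
    (∀ j, i ≤ j → j ≤ m → ∀ v ∈ e j, v ∉ C) ∧
    (∃ c : (SimpleGraph.fromEdgeSet {x | ∃ j, 1 ≤ j ∧ j ≤ m ∧ x = e j}).ConnectedComponent,
      C = c.supp) ∧
    ((∃ j, 1 ≤ j ∧ j ≤ m ∧ ∀ v ∈ e j, v ∉ C) →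
      ¬(SimpleGraph.fromEdgeSet {x | ∃ j, 1 ≤ j ∧ j ≤ m ∧ x = e j}).Connected) := by
  have hfuture : ∀ j, i ≤ j → j ≤ m → ∀ v ∈ e j, v ∉ C := by
    intro j hij hjm v hv hvC
    have hvC' := hvC
    rw [hC] at hvC'
    obtain ⟨u, hu, hr⟩ := hvC'
    obtain ⟨_, ⟨a, ha, hai, rfl⟩, hva⟩ :=
      hr.exists_mem_of_fromEdgeSet ⟨i - k - 1, by omega, by omega, rfl⟩ hu
    by_cases hw : i - k ≤ a
    · exact hwin a hw hai v hva hvC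
    · have := abs_le.1 (hloc v a j ha (by omega) (by omega) hjm hva hv)
      omega
  obtain ⟨p, hp⟩ : ∃ p, p ∈ e (i - k - 1) := ⟨_, Sym2.out_fst_mem _⟩
  have hpC : p ∈ C := by
    rw [hC]
    exact ⟨p, hp, .rfl⟩
  have hclosed : ∀ x y, (SimpleGraph.fromEdgeSet {x | ∃ j, 1 ≤ j ∧ j ≤ m ∧ x = e j}).Adj x y →
      x ∈ C → y ∈ C := by
    intro x y hxy hx
    obtain ⟨⟨j, hj, hjm, hej⟩, hne⟩ := (SimpleGraph.fromEdgeSet_adj _).1 hxy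
    have hji : j ≤ i - 1 := by
      by_contra hlt
      exact hfuture j (by omega) hjm x (hej ▸ Sym2.mem_mk_left x y) hx
    rw [hC] at hx ⊢
    obtain ⟨u, hu, hr⟩ := hx
    have hadj : (SimpleGraph.fromEdgeSet {x | ∃ j, 1 ≤ j ∧ j ≤ i - 1 ∧ x = e j}).Adj x y :=
      (SimpleGraph.fromEdgeSet_adj _).2 ⟨⟨j, hj, hji, hej⟩, hne⟩
    exact ⟨u, hu, hadj.symm.reachable.trans hr⟩
  refine ⟨hfuture, ⟨SimpleGraph.connectedComponentMk _ p, ?_⟩, ?_⟩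
  · ext v
    rw [SimpleGraph.ConnectedComponent.mem_supp_iff, SimpleGraph.ConnectedComponent.eq]
    refine ⟨fun hv => ?_, fun hv => hv.symm.mem_of_adj_closed hclosed hpC⟩
    rw [hC] at hv
    obtain ⟨u, hu, hr⟩ := hv
    refine (hr.mono (SimpleGraph.fromEdgeSet_mono ?_)).trans ?_
    · rintro x ⟨j, hj, hji, rfl⟩
      exact ⟨j, hj, by omega, rfl⟩
    · by_cases hup : u = p
      · exact hup ▸ .rfl
      · refine SimpleGraph.Adj.reachable ((SimpleGraph.fromEdgeSet_adj _).2
          ⟨⟨i - k - 1, by omega, by omega, ?_⟩, hup⟩)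
        exact ((Sym2.mem_and_mem_iff hup).1 ⟨hu, hp⟩).symm
  · rintro ⟨j, -, -, hj⟩ hconn
    exact hj _ (Sym2.out_fst_mem _) ((hconn.preconnected p _).mem_of_adj_closed hclosed hpC)
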